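/- Let K be a field, R := K[x₁,…,xₙ] a polynomial ring, let f₁,…,f_r ∈ R, h ∈ R, and I := (f₁,…,f_r). Assume that for every prime ideal P of R with h ∉ P, the images of f₁,…,f_r in the localization R_P form a weakly regular sequence (i.e., for each i, the image of fᵢ is a nonzerodivisor on R_P/(f₁,…,f_{i−1})R_P). Then for every minimal prime P over I with h ∉ P, the Krull dimension of the quotient ring R/P equals n − r. (In geometric terms: the locally closed set V(I) \ V(h) is equidimensional of codimension r.) -/

import Mathlib

namespace Ideal

variable {R : Type*} [CommRing R]

/-- The height of a prime ideal plus the dimension of its quotient is at most `dim R`. -/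
lemma height_add_ringKrullDim_quotient_le (P : Ideal R) [hP : P.IsPrime] :
    P.height + ringKrullDim (R ⧸ P) ≤ ringKrullDim R := by
  let x : PrimeSpectrum R := ⟨P, hP⟩
  have hx : PrimeSpectrum.zeroLocus (P : Set R) = Set.Ici x := Set.ext fun _ ↦ Iff.rfl
  have : Nonempty (PrimeSpectrum R) := ⟨x⟩
  rw [ringKrullDim_quotient, hx, show P.height = Order.height x from x.height_eq_orderHeight,
    ← Order.coheight_eq_krullDim_Ici, ringKrullDim,
    Order.krullDim_eq_iSup_height_add_coheight_of_nonempty, ← WithBot.coe_add, WithBot.coe_le_coe]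
  exact le_iSup (fun a : PrimeSpectrum R ↦ Order.height a + Order.coheight a) x

/-- If `P` is the only minimal prime over `I` contained in the prime `M`, then the height of
`M ⧸ I` is at most `dim (R ⧸ P)`. -/
lemma height_map_quotient_le_ringKrullDim_quotient {I P M : Ideal R} [M.IsPrime] (hIM : I ≤ M)
    (h : ∀ Q ∈ I.minimalPrimes, Q ≤ M → Q = P) :
    (M.map (Quotient.mk I)).height ≤ ringKrullDim (R ⧸ P) := by
  have hM : (M.map (Quotient.mk I)).IsPrime := isPrime_map_quotientMk_of_isPrime hIM
  let x : PrimeSpectrum (R ⧸ I) := ⟨M.map (Quotient.mk I), hM⟩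
  have hcomap : (M.map (Quotient.mk I)).comap (Quotient.mk I) = M := by
    rw [comap_map_of_surjective' _ Quotient.mk_surjective, mk_ker, sup_eq_left.mpr hIM]
  have hle (q : Set.Iic x) : P ≤ q.1.asIdeal.comap (Quotient.mk I) := by
    have hI : I ≤ q.1.asIdeal.comap (Quotient.mk I) := by
      simpa using ker_le_comap (K := q.1.asIdeal) (Quotient.mk I)
    obtain ⟨Q, hQ, hQq⟩ := exists_minimalPrimes_le hI
    have hqM : q.1.asIdeal.comap (Quotient.mk I) ≤ M := (comap_mono q.2).trans hcomap.le
    exact h Q hQ (hQq.trans hqM) ▸ hQq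
  rw [show (M.map (Quotient.mk I)).height = Order.height x from x.height_eq_orderHeight,
    ringKrullDim_quotient]
  refine (Order.height_eq_krullDim_Iic x).trans_le (Order.krullDim_le_of_strictMono
    (fun q ↦ ⟨PrimeSpectrum.comap (Quotient.mk I) q.1, hle q⟩) ?_)
  exact Monotone.strictMono_of_injective (fun a b hab ↦ comap_mono (f := Quotient.mk I) hab)
    fun a b hab ↦ Subtype.ext <| PrimeSpectrum.comap_injective_of_surjective _
      Quotient.mk_surjective (Subtype.ext_iff.mp hab)

/-- In a Noetherian Jacobson ring, a minimal prime `P` over `I` lies in a maximal ideal that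
contains no other minimal prime over `I`. -/
lemma exists_isMaximal_forall_minimalPrimes_le_imp_eq [IsNoetherianRing R] [IsJacobsonRing R]
    {I P : Ideal R} (hP : P ∈ I.minimalPrimes) :
    ∃ M : Ideal R, M.IsMaximal ∧ P ≤ M ∧ ∀ Q ∈ I.minimalPrimes, Q ≤ M → Q = P := by
  classical
  have hPp : P.IsPrime := hP.1.1
  let s := (I.finite_minimalPrimes_of_isNoetherianRing R).toFinset.erase P
  have hs : ¬ s.inf id ≤ P := by
    rw [hPp.inf_le']
    rintro ⟨Q, hQ, hQP⟩
    simp only [s, Finset.mem_erase, Set.Finite.mem_toFinset] at hQ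
    exact hQ.1 (le_antisymm hQP (hP.2 hQ.2.1 hQP))
  obtain ⟨g, hg, hgP⟩ := SetLike.not_le_iff_exists.mp hs
  rw [← hPp.radical, radical_eq_jacobson, jacobson, Submodule.mem_sInf] at hgP
  push Not at hgP
  obtain ⟨M, ⟨hPM, hM⟩, hgM⟩ := hgP
  refine ⟨M, hM, hPM, fun Q hQ hQM ↦ by_contra fun hne ↦ hgM (hQM ?_)⟩
  have hQs : Q ∈ s := by simpa [s] using ⟨hne, hQ⟩
  exact (Finset.inf_le hQs : s.inf id ≤ Q) hg

/-- Elements of a prime `P` whose images in `R_P` form a weakly regular sequence are at most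
`P.height` in number. -/
lemma length_le_height_of_isWeaklyRegular [IsNoetherianRing R] (P : Ideal R) [P.IsPrime]
    (rs : List R) (hrs : ∀ x ∈ rs, x ∈ P)
    (hreg : RingTheory.Sequence.IsWeaklyRegular (Localization.AtPrime P)
      (rs.map (algebraMap R (Localization.AtPrime P)))) :
    rs.length ≤ P.height := by
  have hmem : ∀ y ∈ rs.map (algebraMap R (Localization.AtPrime P)),
      y ∈ IsLocalRing.maximalIdeal (Localization.AtPrime P) := by
    simp only [List.mem_map, forall_exists_index, and_imp, forall_apply_eq_imp_iff₂]
    exact fun x hx ↦ (IsLocalization.AtPrime.to_map_mem_maximal_iff _ P x).mpr (hrs x hx)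
  have hdim := ringKrullDim_add_length_eq_ringKrullDim_of_isRegular _
    ((IsLocalRing.isRegular_iff_isWeaklyRegular_of_subset_maximalIdeal hmem).mpr hreg)
  have : Nontrivial (Localization.AtPrime P ⧸
      Ideal.ofList (rs.map (algebraMap R (Localization.AtPrime P)))) :=
    Quotient.nontrivial_iff.mpr <| ne_top_of_le_ne_top
      (IsLocalRing.maximalIdeal.isMaximal _).ne_top (span_le.mpr hmem)
  rw [IsLocalization.AtPrime.ringKrullDim_eq_height P (Localization.AtPrime P),
    List.length_map] at hdim
  have h : (rs.length : WithBot ℕ∞) ≤ P.height := by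
    rw [← hdim]
    exact le_add_of_nonneg_left ringKrullDim_nonneg_of_nontrivial
  exact_mod_cast h

end Ideal

/-- Every maximal ideal of a polynomial ring in `n` variables over a field has height `n`. -/
lemma MvPolynomial.height_of_isMaximal {K : Type*} [Field K] {n : ℕ}
    (M : Ideal (MvPolynomial (Fin n) K)) [hM : M.IsMaximal] : M.height = n := by
  induction n with
  | zero =>
    have h : (M.height : WithBot ℕ∞) ≤ ringKrullDim (MvPolynomial (Fin 0) K) :=
      Ideal.height_le_ringKrullDim_of_isPrime
    simp only [ringKrullDim_of_isNoetherianRing, ringKrullDim_eq_zero_of_field] at h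
    simpa using h
  | succ n ih =>
    let e := (finSuccEquiv K n).toRingEquiv
    let N : Ideal (Polynomial (MvPolynomial (Fin n) K)) := M.map e
    have hN : N.IsMaximal := Ideal.map_isMaximal_of_equiv e
    have hp : (N.comap Polynomial.C).IsMaximal :=
      Polynomial.isMaximal_comap_C_of_isJacobsonRing N
    have hNp : N.LiesOver (N.comap Polynomial.C) := ⟨rfl⟩
    rw [← e.height_map M, Polynomial.height_eq_height_add_one (N.comap Polynomial.C) N, ih]
    simp

/-- If `f₁,…,f_r` in `R = K[x₁,…,xₙ]` form a local regular sequence outside `V(h)`, then for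
every minimal prime `P` over `I = (f₁,…,f_r)` with `h ∉ P`, the Krull dimension of `R ⧸ P`
is `n - r`; geometrically, `V(I) \ V(h)` is equidimensional of codimension `r`. -/
theorem krullDim_quotient_minimalPrime_of_locallyRegularSequence
    (K : Type*) [Field K] (n r : ℕ)
    (f : Fin r → MvPolynomial (Fin n) K) (h : MvPolynomial (Fin n) K)
    (hreg : ∀ (P : Ideal (MvPolynomial (Fin n) K)) [P.IsPrime], h ∉ P →
      RingTheory.Sequence.IsWeaklyRegular (Localization.AtPrime P)
        ((List.ofFn f).map
          (algebraMap (MvPolynomial (Fin n) K) (Localization.AtPrime P)))) :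
    ∀ P : Ideal (MvPolynomial (Fin n) K),
      P ∈ (Ideal.span (Set.range f)).minimalPrimes → h ∉ P →
        ringKrullDim (MvPolynomial (Fin n) K ⧸ P) = (n - r : ℕ) := by
  intro P hP hhP
  have hPp : P.IsPrime := hP.1.1
  have hfP : Set.range f ⊆ P := Ideal.span_le.mp hP.1.2
  have hheight : (r : ℕ∞) ≤ P.height := by
    simpa using P.length_le_height_of_isWeaklyRegular (List.ofFn f)
      (by simpa [Set.range_subset_iff] using hfP) (hreg P hhP)
  have hupper : P.height + ringKrullDim (MvPolynomial (Fin n) K ⧸ P) ≤ n := by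
    simpa using P.height_add_ringKrullDim_quotient_le
  obtain ⟨M, hM, hPM, hMP⟩ := Ideal.exists_isMaximal_forall_minimalPrimes_le_imp_eq hP
  have hlower : (n : WithBot ℕ∞) ≤ ringKrullDim (MvPolynomial (Fin n) K ⧸ P) + r := by
    have hcard : (Set.range f).encard ≤ r := by
      simpa [← Set.image_univ] using Set.encard_image_le f Set.univ
    have hle : (n : ℕ∞) ≤ (M.map (Ideal.Quotient.mk (Ideal.span (Set.range f)))).height + r := by
      rw [← MvPolynomial.height_of_isMaximal M]
      exact (Ideal.height_le_height_add_encard_of_subset _ (hfP.trans hPM)).trans (by gcongr)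
    refine (WithBot.coe_le_coe.mpr hle).trans ?_
    rw [WithBot.coe_add]
    exact add_le_add_left
      (Ideal.height_map_quotient_le_ringKrullDim_quotient (hP.1.2.trans hPM) hMP) _
  have hsum : (r : WithBot ℕ∞) + ringKrullDim (MvPolynomial (Fin n) K ⧸ P) ≤ n := by
    refine le_trans ?_ hupper
    gcongr
    exact_mod_cast hheight
  generalize ringKrullDim (MvPolynomial (Fin n) K ⧸ P) = d at hlower hsum
  induction d with
  | bot => simp at hlower
  | coe d =>
    norm_cast at hlower hsum
    induction d with
    | top => simp at hsum
    | coe d =>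
      norm_cast at hlower hsum
      rw [show d = n - r by omega]
      rfl
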